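/- arXiv:1401.5583 — 5 statements merged into one kernel-verified Lean document; each statement's English description precedes it below -/
import Mathlib

section
/- Let h > 0, ℓ > 0 and 0 < r < 1 be real numbers. Let k_1, …, k_n be real numbers with hr < k_i ≤ h for every i and k_1 + ⋯ + k_n ≤ ℓ. Let h_Q be a real number with hr < h_Q ≤ h such that k_1 + ⋯ + k_n + h_Q > ℓ. Then k_1² + ⋯ + k_n² + h_Q² > ℓhr − (hr)² + h_Q·h·r. -/
/-- Lemma 1 (generalized Moon–Moser): if squares of heights `k i ∈ (h*r, h]` are packed
into a shelf of height `h`, length `ℓ`, packing ratio `r ∈ (0,1)`, and a square of height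
`h_Q ∈ (h*r, h]` does not fit, then the total area of the packed squares plus the area of
the new square exceeds `ℓ*h*r - (h*r)^2 + h_Q*h*r`. -/
theorem shelf_packing_lemma (h ℓ r : ℝ) (n : ℕ) (k : Fin n → ℝ) (h_Q : ℝ)
    (hh : 0 < h) (hℓ : 0 < ℓ) (hr0 : 0 < r) (hr1 : r < 1)
    (hk : ∀ i, h * r < k i ∧ k i ≤ h)
    (hfit : ∑ i, k i ≤ ℓ)
    (hQ1 : h * r < h_Q) (hQ2 : h_Q ≤ h)
    (hnofit : ∑ i, k i + h_Q > ℓ) :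
    ∑ i, (k i) ^ 2 + h_Q ^ 2 > ℓ * h * r - (h * r) ^ 2 + h_Q * h * r := by
  have ha : 0 < h * r := mul_pos hh hr0
  have h1 : (h * r) * ∑ i, k i ≤ ∑ i, (k i) ^ 2 := by
    rw [Finset.mul_sum]
    apply Finset.sum_le_sum
    intro i _
    nlinarith [(hk i).1]
  have h2 : 0 < (h * r) * (∑ i, k i + h_Q - ℓ) := mul_pos ha (by linarith)
  nlinarith [sq_nonneg (h_Q - h * r)]
end

section
/- Let h > 0, ℓ > 0 and 0 < r < 1 be real numbers. Let k_1, …, k_n be real numbers with hr < k_i ≤ h for every i and k_1 + ⋯ + k_n ≤ ℓ. Let h_Q be a real number with hr < h_Q ≤ h such that k_1 + ⋯ + k_n + h_Q > ℓ. Then k_1² + ⋯ + k_n² + h_Q·(h_Q − hr) > ℓhr − (hr)², and moreover 0 ≤ h_Q·(h_Q − hr) ≤ h_Q², so an area of ℓhr − (hr)² can be assigned to the closed shelf using only the packed squares and part of the area of Q. -/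
/-- Corollary 1: a closed shelf can be assigned an area of `ℓ*h*r - (h*r)^2` using only the
packed squares and the part `h_Q*(h_Q - h*r)` of the area of the closing square `Q`. -/
theorem shelf_packing_corollary (h ℓ r : ℝ) (n : ℕ) (k : Fin n → ℝ) (h_Q : ℝ)
    (hh : 0 < h) (hℓ : 0 < ℓ) (hr0 : 0 < r) (hr1 : r < 1)
    (hk : ∀ i, h * r < k i ∧ k i ≤ h)
    (hfit : ∑ i, k i ≤ ℓ)
    (hQ1 : h * r < h_Q) (hQ2 : h_Q ≤ h)
    (hnofit : ∑ i, k i + h_Q > ℓ) :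
    ∑ i, (k i) ^ 2 + h_Q * (h_Q - h * r) > ℓ * h * r - (h * r) ^ 2 ∧
      0 ≤ h_Q * (h_Q - h * r) ∧ h_Q * (h_Q - h * r) ≤ h_Q ^ 2 := by
  have ha : 0 < h * r := mul_pos hh hr0
  have hs : h * r * ∑ i, k i ≤ ∑ i, (k i) ^ 2 := by
    rw [Finset.mul_sum]
    apply Finset.sum_le_sum
    intro i _
    nlinarith [(hk i).1]
  have hm : h * r * ℓ < h * r * (∑ i, k i + h_Q) := mul_lt_mul_of_pos_left hnofit ha
  refine ⟨?_, ?_, ?_⟩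
  · nlinarith [sq_nonneg (h_Q - h * r)]
  · exact mul_nonneg (by linarith) (by linarith)
  · nlinarith [mul_pos ha (ha.trans hQ1)]
end

section
/- Let k_1, …, k_n be real numbers with 1/4 < k_i ≤ 1/2 for every i and k_1² + ⋯ + k_n² ≤ 3/8. Suppose there is an index j (1 ≤ j ≤ n) such that k_1 + ⋯ + k_{j−1} ≤ 1 and k_1 + ⋯ + k_{j−1} + k_j > 1. Then k_j + k_{j+1} + ⋯ + k_n ≤ 0.692. -/
/-- Lemma 2: medium squares (heights in `(1/4, 1/2]`, total area at most `3/8`) are packed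
greedily in arrival order into a bottom shelf of length `1`; if the square `k j` is the first
that overflows the bottom shelf, then it and all later medium squares fit in a top shelf of
length `0.692`. -/
theorem medium_squares_fit_top_shelf (n : ℕ) (k : Fin n → ℝ) (j : Fin n)
    (hmed : ∀ i, 1 / 4 < k i ∧ k i ≤ 1 / 2)
    (harea : ∑ i, (k i) ^ 2 ≤ 3 / 8)
    (hbelow : ∑ i ∈ Finset.univ.filter (· < j), k i ≤ 1)
    (hclose : ∑ i ∈ Finset.univ.filter (· < j), k i + k j > 1) :
    ∑ i ∈ Finset.univ.filter (j ≤ ·), k i ≤ 0.692 := by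
  classical
  set B := Finset.univ.filter (· < j) with hB
  set C := Finset.univ.filter (j < ·) with hC
  have hins : Finset.univ.filter (j ≤ ·) = insert j C := by
    ext i
    simp only [hC, Finset.mem_filter, Finset.mem_univ, true_and, Finset.mem_insert]
    rw [le_iff_eq_or_lt, eq_comm]
  have hjC : j ∉ C := by simp [hC]
  have htot : ∑ i, (k i) ^ 2 = ∑ i ∈ B, (k i) ^ 2 + ((k j) ^ 2 + ∑ i ∈ C, (k i) ^ 2) := by
    rw [← Finset.sum_insert hjC (f := fun i => (k i) ^ 2), ← hins,
      ← Finset.sum_filter_add_sum_filter_not Finset.univ (· < j)]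
    simp only [not_lt, hB]
  rw [hins, Finset.sum_insert hjC]
  rw [htot] at harea
  have hsq : ∀ i, 1 / 16 ≤ (k i) ^ 2 := fun i => by nlinarith [(hmed i).1]
  have lowQ := Finset.card_nsmul_le_sum B (fun i => (k i) ^ 2) (1 / 16) (fun i _ => hsq i)
  have lowR := Finset.card_nsmul_le_sum C (fun i => (k i) ^ 2) (1 / 16) (fun i _ => hsq i)
  have lowS := Finset.card_nsmul_le_sum B k (1 / 4) (fun i _ => (hmed i).1.le)
  have upS := Finset.sum_le_card_nsmul B k (1 / 2) (fun i _ => (hmed i).2)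
  have upT := Finset.sum_le_card_nsmul C k (1 / 2) (fun i _ => (hmed i).2)
  have cS := sq_sum_le_card_mul_sum_sq (s := B) (f := k)
  have cT := sq_sum_le_card_mul_sum_sq (s := C) (f := k)
  obtain ⟨hx1, hx2⟩ := hmed j
  have hx3 : 1 / 16 < (k j) ^ 2 := by nlinarith
  simp only [nsmul_eq_mul] at lowQ lowR lowS upS upT
  generalize ∑ i ∈ B, k i = S at *
  generalize ∑ i ∈ C, k i = T at *
  generalize ∑ i ∈ B, (k i) ^ 2 = Q at *
  generalize ∑ i ∈ C, (k i) ^ 2 = R at *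
  generalize k j = x at *
  generalize B.card = m at *
  generalize C.card = r at *
  have h1 : m + r < 5 := by
    have : (m : ℝ) + r < 5 := by linarith
    exact_mod_cast this
  have h2 : 1 < m := by
    have : (1 : ℝ) < m := by linarith
    exact_mod_cast this
  rcases Nat.eq_zero_or_pos r with h0 | h0
  · subst h0
    norm_num at upT ⊢
    linarith
  have h0' : (1 : ℝ) ≤ r := by exact_mod_cast h0
  obtain h3 | ⟨h3, h4⟩ : m = 2 ∨ (m = 3 ∧ r = 1) := by omega
  · subst h3
    push_cast at cS
    exfalso
    nlinarith [sq_nonneg (x - 1 / 3), sq_nonneg (S - 2 / 3)]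
  · subst h3 h4
    norm_num at cS cT lowS ⊢
    have : (3 / 4) ^ 2 ≤ S ^ 2 := by gcongr
    nlinarith [sq_nonneg (x - T)]
end

section
/- Let h > 0 and let r be a real number with √(1/2) ≤ r < 1. Let k_1, …, k_n be real numbers with hr < k_i ≤ h for every i and k_1 + ⋯ + k_n ≤ 2h, and suppose there exists a real number h_Q with hr < h_Q ≤ h and k_1 + ⋯ + k_n + h_Q > 2h. Then n = 2 and k_1² + ⋯ + k_n² ≥ h² (i.e., the closed shelf of length ℓ = 2h has covered area at least ℓh/2). -/
/-- Lemma 4: a closed shelf of length `ℓ = 2h` with packing ratio `r ≥ √(1/2)` contains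
exactly two squares and has covered area at least `h² = ℓh/2`. -/
theorem closed_shelf_length_two_h (h r : ℝ) (n : ℕ) (k : Fin n → ℝ)
    (hh : 0 < h) (hr1 : Real.sqrt (1 / 2) ≤ r) (hr2 : r < 1)
    (hk : ∀ i, h * r < k i ∧ k i ≤ h)
    (hfit : ∑ i, k i ≤ 2 * h)
    (hclose : ∃ h_Q : ℝ, h * r < h_Q ∧ h_Q ≤ h ∧ ∑ i, k i + h_Q > 2 * h) :
    n = 2 ∧ ∑ i, (k i) ^ 2 ≥ h ^ 2 := by
  obtain ⟨q, hq1, hq2, hq3⟩ := hclose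
  have hr0 : 0 ≤ r := le_trans (Real.sqrt_nonneg _) hr1
  have hrsq : 1 / 2 ≤ r ^ 2 := (Real.sqrt_le_left hr0).mp hr1
  have hr : 2 / 3 < r := by nlinarith
  have hlo : (n : ℝ) * (h * r) ≤ ∑ i, k i := by
    have := Finset.sum_le_sum (s := Finset.univ) (fun i _ => (hk i).1.le)
    simpa using this
  have hhi : ∑ i, k i ≤ (n : ℝ) * h := by
    have := Finset.sum_le_sum (s := Finset.univ) (fun i _ => (hk i).2)
    simpa using this
  have hn1 : (1 : ℝ) < n := by
    by_contra hc
    push Not at hc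
    nlinarith
  have hhr : 2 / 3 * h < h * r := by nlinarith
  have hn3 : (n : ℝ) < 3 := by
    by_contra hc
    push Not at hc
    nlinarith
  have hn1' : 1 < n := by exact_mod_cast hn1
  have hn3' : n < 3 := by exact_mod_cast hn3
  obtain rfl : n = 2 := by omega
  refine ⟨rfl, ?_⟩
  have hsq : ∀ i, h ^ 2 / 2 ≤ k i ^ 2 := fun i => by
    have h1 : (h * r) ^ 2 ≤ k i ^ 2 :=
      pow_le_pow_left₀ (mul_nonneg hh.le hr0) (hk i).1.le 2
    nlinarith [mul_le_mul_of_nonneg_left hrsq (sq_nonneg h)]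
  rw [Fin.sum_univ_two]
  linarith [hsq 0, hsq 1]
end

section
/- Let h > 0, ε > 0 and ℓ ≥ (2 + ε)·h be real numbers. Then there exists a real number r with 0 < r < 1 such that r − h·r²/ℓ ≥ 1/2; and for any such r, ℓ·h·r − (h·r)² ≥ ℓ·h/2. -/
/-- Lemma 5: if `ℓ ≥ (2 + ε)h`, a packing ratio `r ∈ (0,1)` with `r - h·r²/ℓ ≥ 1/2` exists,
and for any such `r` the closed shelf is covered to density at least `1/2`:
`ℓ·h·r - (h·r)² ≥ ℓ·h/2`. -/
theorem closed_shelf_long_length (h ε ℓ : ℝ)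
    (hh : 0 < h) (hε : 0 < ε) (hℓ : (2 + ε) * h ≤ ℓ) :
    (∃ r : ℝ, 0 < r ∧ r < 1 ∧ r - h * r ^ 2 / ℓ ≥ 1 / 2) ∧
      ∀ r : ℝ, 0 < r → r < 1 → r - h * r ^ 2 / ℓ ≥ 1 / 2 →
        ℓ * h * r - (h * r) ^ 2 ≥ ℓ * h / 2 := by
  have hl2 : 2 * h < ℓ := by nlinarith [mul_pos hε hh]
  have hl : 0 < ℓ := by linarith
  have key : ∀ r : ℝ, h * r ^ 2 / ℓ = (h / ℓ) * r ^ 2 := fun r => by ring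
  have hc0 : 0 < h / ℓ := div_pos hh hl
  have hc : h / ℓ < 1 / 2 := by
    rw [div_lt_iff₀ hl]; linarith
  have hcl : h / ℓ * ℓ = h := div_mul_cancel₀ h hl.ne'
  refine ⟨⟨1 / 2 + h / ℓ, by linarith, by linarith, ?_⟩, ?_⟩
  · rw [key]
    have h1 : (1 / 2 + h / ℓ) ^ 2 ≤ 1 := by nlinarith
    nlinarith [mul_le_mul_of_nonneg_left h1 hc0.le]
  · intro r _ _ hr
    have h2 : h * r ^ 2 / ℓ * ℓ = h * r ^ 2 := div_mul_cancel₀ _ hl.ne'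
    have h3 := mul_le_mul_of_nonneg_right hr (mul_pos hl hh).le
    have h4 : (r - h * r ^ 2 / ℓ) * (ℓ * h) = ℓ * h * r - (h * r) ^ 2 := by
      have : (r - h * r ^ 2 / ℓ) * (ℓ * h) = ℓ * h * r - (h * r ^ 2 / ℓ * ℓ) * h := by ring
      rw [this, h2]; ring
    linarith
end
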